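/- For b > a > 0, the double integral ∫_a^b [t log x / √((b−x)(x−a))] · (⨍_a^b [t/y · √((b−y)(y−a))/(x−y)] dy) dx equals (2πt)² log((√a + √b)/(2(ab)^{1/4})) for any real t. -/

import Mathlib

open Real Filter

lemma aux_d1 (a b : ℝ) (hab : a < b) (y : ℝ) (hy : y ∈ Set.Ioo a b) :
    HasDerivAt (fun y => arcsin ((2 * y - a - b) / (b - a))) (1 / √((b - y) * (y - a))) y := by
  obtain ⟨h1, h2⟩ := hy
  have hba : 0 < b - a := by linarith
  have hR : 0 < (b - y) * (y - a) := mul_pos (by linarith) (by linarith)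
  have hne1 : (2 * y - a - b) / (b - a) ≠ -1 := by
    intro h; rw [div_eq_iff hba.ne'] at h; linarith
  have hne2 : (2 * y - a - b) / (b - a) ≠ 1 := by
    intro h; rw [div_eq_iff hba.ne'] at h; linarith
  have hs : HasDerivAt (fun y => (2 * y - a - b) / (b - a)) (2 / (b - a)) y := by
    have := ((((hasDerivAt_id y).const_mul 2).sub_const a).sub_const b).div_const (b - a)
    simpa using this
  have := (hasDerivAt_arcsin hne1 hne2).comp y hs
  refine HasDerivAt.congr_deriv this ?_
  have e : 1 - ((2 * y - a - b) / (b - a)) ^ 2 = (2 * √((b - y) * (y - a)) / (b - a)) ^ 2 := by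
    rw [div_pow, div_pow, mul_pow, Real.sq_sqrt hR.le]
    field_simp
    ring
  have hq : 0 < √((b - y) * (y - a)) := Real.sqrt_pos.2 hR
  rw [e, Real.sqrt_sq (by positivity)]
  field_simp

lemma aux_R (a b : ℝ) (ha : 0 < a) (hab : a < b) (y : ℝ) (hy : y ∈ Set.Ioo a b) :
    √((b - a * b / y) * (a * b / y - a)) = √(a * b) * √((b - y) * (y - a)) / y := by
  obtain ⟨h1, h2⟩ := hy
  have hy0 : 0 < y := by linarith
  have hb : 0 < b := by linarith
  have : (b - a * b / y) * (a * b / y - a) = (a * b) * ((b - y) * (y - a)) / y ^ 2 := by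
    field_simp
  rw [this, Real.sqrt_div' _ (by positivity), Real.sqrt_sq hy0.le, Real.sqrt_mul (by positivity)]

lemma aux_mem (a b : ℝ) (ha : 0 < a) (hab : a < b) (y : ℝ) (hy : y ∈ Set.Ioo a b) :
    a * b / y ∈ Set.Ioo a b := by
  obtain ⟨h1, h2⟩ := hy
  have hy0 : 0 < y := by linarith
  constructor
  · rw [lt_div_iff₀ hy0]; nlinarith
  · rw [div_lt_iff₀ hy0]; nlinarith

lemma aux_d2 (a b : ℝ) (ha : 0 < a) (hab : a < b) (y : ℝ) (hy : y ∈ Set.Ioo a b) :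
    HasDerivAt (fun y => arcsin ((2 * (a * b / y) - a - b) / (b - a)))
      (- √(a * b) / (y * √((b - y) * (y - a)))) y := by
  have h1 := aux_d1 a b hab _ (aux_mem a b ha hab y hy)
  have hy0 : 0 < y := by linarith [hy.1]
  have hb : 0 < b := by linarith
  have h2 : HasDerivAt (fun y : ℝ => a * b / y) (-(a * b) / y ^ 2) y := by
    have := (hasDerivAt_const y (a * b)).div (hasDerivAt_id y) hy0.ne'
    refine HasDerivAt.congr_deriv this ?_
    simp
  have := h1.comp y h2
  refine HasDerivAt.congr_deriv this ?_
  rw [aux_R a b ha hab y hy]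
  have hR : 0 < (b - y) * (y - a) := mul_pos (by linarith [hy.2]) (by linarith [hy.1])
  have hq : 0 < √((b - y) * (y - a)) := Real.sqrt_pos.2 hR
  have hs : 0 < √(a * b) := Real.sqrt_pos.2 (by positivity)
  have hs2 : √(a * b) ^ 2 = a * b := Real.sq_sqrt (by positivity)
  symm
  field_simp
  linarith

lemma aux_d3 (a b x : ℝ) (hx : x ∈ Set.Ioo a b) (y : ℝ) (hy : y ∈ Set.Ioo a b) (hxy : x ≠ y) :
    HasDerivAt (fun y => 2 * log (√(y - a) * √(b - x) + √(x - a) * √(b - y)) - log (x - y))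
      (√(x - a) * √(b - x) / ((x - y) * √((b - y) * (y - a)))) y := by
  obtain ⟨h1, h2⟩ := hx
  obtain ⟨h3, h4⟩ := hy
  have hP : 0 < √(x - a) := Real.sqrt_pos.2 (by linarith)
  have hQ : 0 < √(b - x) := Real.sqrt_pos.2 (by linarith)
  have hp : 0 < √(y - a) := Real.sqrt_pos.2 (by linarith)
  have hq : 0 < √(b - y) := Real.sqrt_pos.2 (by linarith)
  have eP : √(x - a) ^ 2 = x - a := Real.sq_sqrt (by linarith)
  have eQ : √(b - x) ^ 2 = b - x := Real.sq_sqrt (by linarith)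
  have ep : √(y - a) ^ 2 = y - a := Real.sq_sqrt (by linarith)
  have eq : √(b - y) ^ 2 = b - y := Real.sq_sqrt (by linarith)
  have d1 : HasDerivAt (fun y => √(y - a)) (1 / (2 * √(y - a))) y :=
    ((hasDerivAt_id y).sub_const a).sqrt (by simp; linarith)
  have d2 : HasDerivAt (fun y => √(b - y)) (-1 / (2 * √(b - y))) y :=
    ((hasDerivAt_id y).const_sub b).sqrt (by simp; linarith)
  have hxy' : x - y ≠ 0 := sub_ne_zero.2 hxy
  have d3 : HasDerivAt (fun y => log (x - y)) (-1 / (x - y)) y :=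
    ((hasDerivAt_id y).const_sub x).log hxy'
  have hpos : 0 < √(y - a) * √(b - x) + √(x - a) * √(b - y) := by positivity
  have := ((((d1.mul_const (√(b - x))).add (d2.const_mul (√(x - a)))).log hpos.ne').const_mul 2).sub d3
  refine HasDerivAt.congr_deriv this ?_
  rw [Real.sqrt_mul (by linarith)]
  simp only [Pi.add_apply]
  have key : ∀ P Q p q d : ℝ, 0 < P → 0 < Q → 0 < p → 0 < q → d ≠ 0 → P ^ 2 - p ^ 2 = d →
      q ^ 2 - Q ^ 2 = d → P * Q / (d * (q * p)) =
      2 * ((1 / (2 * p) * Q + P * (-1 / (2 * q))) / (p * Q + P * q)) - -1 / d := by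
    intro P Q p q d hP hQ hp hq hd e1 e2
    have : p * Q + P * q ≠ 0 := by positivity
    field_simp
    linear_combination (Q * q) * e1 - P * p * e2
  exact (key _ _ _ _ _ hP hQ hp hq hxy' (by linarith) (by linarith)).symm

lemma aux_J1 (a b : ℝ) (ha : 0 < a) (hab : a < b) :
    ∫ θ in (0:ℝ)..π, log ((a + b) / 2 - (b - a) / 2 * cos θ) = 2 * π * log ((√a + √b) / 2) := by
  have hb : 0 < b := ha.trans hab
  have hsa : 0 < √a := Real.sqrt_pos.2 ha
  have hsb : 0 < √b := Real.sqrt_pos.2 hb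
  have hlt : √a < √b := Real.sqrt_lt_sqrt ha.le hab
  have ea : √a ^ 2 = a := Real.sq_sqrt ha.le
  have eb : √b ^ 2 = b := Real.sq_sqrt hb.le
  set f : ℝ → ℝ := fun θ => log ((a + b) / 2 - (b - a) / 2 * cos θ) with hf
  have hcont : Continuous f := by
    apply Continuous.log (by fun_prop)
    intro θ
    have := Real.cos_le_one θ
    nlinarith
  have h1 := circleAverage_log_norm_sub_const_of_mem_closedBall (a := (((√b - √a) / 2 : ℝ) : ℂ))
    (c := 0) (R := (√a + √b) / 2) (by
      rw [mem_closedBall_zero_iff, Complex.norm_real, Real.norm_eq_abs, abs_of_pos (by linarith), abs_of_pos (by linarith)]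
      linarith)
  rw [Real.circleAverage_def] at h1
  have h2 : ∀ θ : ℝ, log ‖circleMap 0 ((√a + √b) / 2) θ - (((√b - √a) / 2 : ℝ) : ℂ)‖ = 1 / 2 * f θ := by
    intro θ
    have : ‖circleMap 0 ((√a + √b) / 2) θ - (((√b - √a) / 2 : ℝ) : ℂ)‖ ^ 2
        = (a + b) / 2 - (b - a) / 2 * cos θ := by
      rw [← Complex.normSq_eq_norm_sq, Complex.normSq_apply, circleMap_zero]
      simp only [Complex.sub_re, Complex.sub_im, Complex.re_ofReal_mul, Complex.im_ofReal_mul,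
        Complex.exp_ofReal_mul_I_re, Complex.exp_ofReal_mul_I_im, Complex.ofReal_re, Complex.ofReal_im]
      have := Real.sin_sq_add_cos_sq θ
      linear_combination ((√a + √b) / 2) ^ 2 * this + (1 + cos θ) / 2 * ea + (1 - cos θ) / 2 * eb
    rw [hf]
    simp only
    rw [← this, Real.log_pow]
    push_cast; ring
  simp_rw [h2] at h1
  rw [intervalIntegral.integral_const_mul] at h1
  have h3 : ∫ θ in π..(2*π), f θ = ∫ θ in (0:ℝ)..π, f θ := by
    have := intervalIntegral.integral_comp_sub_left f (2 * π) (a := 0) (b := π)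
    rw [show 2 * π - π = π by ring, sub_zero] at this
    rw [← this]
    simp [hf, Real.cos_two_pi_sub]
  rw [← intervalIntegral.integral_add_adjacent_intervals (hcont.intervalIntegrable 0 π)
    (hcont.intervalIntegrable π (2*π)), h3, smul_eq_mul] at h1
  have := Real.pi_pos
  field_simp at h1
  linarith

/-- Antiderivative of the inner integrand (for `t = 1`). -/
noncomputable def auxG (a b x y : ℝ) : ℝ :=
  arcsin ((2 * y - a - b) / (b - a)) + √(a * b) / x * arcsin ((2 * (a * b / y) - a - b) / (b - a))
    + √(x - a) * √(b - x) / x *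
      (2 * log (√(y - a) * √(b - x) + √(x - a) * √(b - y)) - log (x - y))

lemma aux_pos (a b x : ℝ) (hx : x ∈ Set.Ioo a b) (y : ℝ) (hy : y ∈ Set.Icc a b) :
    0 < √(y - a) * √(b - x) + √(x - a) * √(b - y) := by
  obtain ⟨h1, h2⟩ := hx
  obtain ⟨h3, h4⟩ := hy
  have hP : 0 < √(x - a) := Real.sqrt_pos.2 (by linarith)
  have hQ : 0 < √(b - x) := Real.sqrt_pos.2 (by linarith)
  rcases lt_or_ge a y with h | h
  · have hp : 0 < √(y - a) := Real.sqrt_pos.2 (by linarith)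
    positivity
  · have hq : 0 < √(b - y) := Real.sqrt_pos.2 (by linarith)
    positivity

lemma aux_ftc (a b t x : ℝ) (ha : 0 < a) (hab : a < b) (hx : x ∈ Set.Ioo a b) (u v : ℝ)
    (hu : a ≤ u) (huv : u ≤ v) (hv : v ≤ b) (hxn : ∀ y ∈ Set.Icc u v, x ≠ y) :
    ∫ y in u..v, t / y * √((b - y) * (y - a)) / (x - y) = t * auxG a b x v - t * auxG a b x u := by
  have hx0 : 0 < x := ha.trans hx.1
  have hb : 0 < b := ha.trans hab
  apply intervalIntegral.integral_eq_sub_of_hasDerivAt_of_le (f := fun y => t * auxG a b x y) huv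
  · unfold auxG
    have h0 : ∀ y ∈ Set.Icc u v, y ≠ 0 := fun y hy => by linarith [hy.1]
    have h1 : ∀ y ∈ Set.Icc u v, √(y - a) * √(b - x) + √(x - a) * √(b - y) ≠ 0 := fun y hy =>
      (aux_pos a b x hx y ⟨hu.trans hy.1, hy.2.trans hv⟩).ne'
    have h2 : ∀ y ∈ Set.Icc u v, x - y ≠ 0 := fun y hy => sub_ne_zero.2 (hxn y hy)
    have c1 : ContinuousOn (fun y => arcsin ((2 * (a * b / y) - a - b) / (b - a))) (Set.Icc u v) := by
      apply Real.continuous_arcsin.comp_continuousOn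
      fun_prop (disch := assumption)
    have c2 : ContinuousOn (fun y => arcsin ((2 * y - a - b) / (b - a))) (Set.Icc u v) := by
      apply Real.continuous_arcsin.comp_continuousOn
      fun_prop
    have c3 : ContinuousOn (fun y => log (√(y - a) * √(b - x) + √(x - a) * √(b - y)))
        (Set.Icc u v) := ContinuousOn.log (by fun_prop) h1
    have c4 : ContinuousOn (fun y => log (x - y)) (Set.Icc u v) := ContinuousOn.log (by fun_prop) h2
    fun_prop
  · intro y hy
    have hyI : y ∈ Set.Ioo a b := ⟨hu.trans_lt hy.1, hy.2.trans_le hv⟩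
    have hxy : x ≠ y := hxn y ⟨hy.1.le, hy.2.le⟩
    have d1 := aux_d1 a b hab y hyI
    have d2 := (aux_d2 a b ha hab y hyI).const_mul (√(a * b) / x)
    have d3 := (aux_d3 a b x hx y hyI hxy).const_mul (√(x - a) * √(b - x) / x)
    have := (((d1.add d2).add d3).const_mul t)
    refine HasDerivAt.congr_deriv this ?_
    have hR : 0 < (b - y) * (y - a) := mul_pos (by linarith [hyI.2]) (by linarith [hyI.1])
    have hq : 0 < √((b - y) * (y - a)) := Real.sqrt_pos.2 hR
    have eR : √((b - y) * (y - a)) ^ 2 = (b - y) * (y - a) := Real.sq_sqrt hR.le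
    have es : √(a * b) ^ 2 = a * b := Real.sq_sqrt (by positivity)
    have eP : √(x - a) ^ 2 = x - a := Real.sq_sqrt (by linarith [hx.1])
    have eQ : √(b - x) ^ 2 = b - x := Real.sq_sqrt (by linarith [hx.2])
    have hy0 : 0 < y := ha.trans hyI.1
    have hxy' : x - y ≠ 0 := sub_ne_zero.2 hxy
    generalize √((b - y) * (y - a)) = R at *
    generalize √(a * b) = s at *
    generalize √(x - a) = P at *
    generalize √(b - x) = Q at *
    field_simp
    rw [es, eR, eP, eQ]
    ring
  · apply ContinuousOn.intervalIntegrable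
    rw [Set.uIcc_of_le huv]
    have h0 : ∀ y ∈ Set.Icc u v, y ≠ 0 := fun y hy => by linarith [hy.1]
    have h2 : ∀ y ∈ Set.Icc u v, x - y ≠ 0 := fun y hy => sub_ne_zero.2 (hxn y hy)
    fun_prop (disch := assumption)

lemma auxG_a (a b x : ℝ) (ha : 0 < a) (hab : a < b) (hx : x ∈ Set.Ioo a b) :
    auxG a b x a = - (π / 2) + √(a * b) / x * (π / 2) + √(x - a) * √(b - x) / x * log (b - a) := by
  unfold auxG
  have hba : 0 < b - a := by linarith
  have hxa : 0 < x - a := by linarith [hx.1]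
  have e1 : (2 * a - a - b) / (b - a) = -1 := by field_simp; ring
  have e2 : (2 * (a * b / a) - a - b) / (b - a) = 1 := by field_simp; ring
  rw [e1, e2, arcsin_neg_one, arcsin_one, sub_self, Real.sqrt_zero, zero_mul, zero_add,
    Real.log_mul (Real.sqrt_pos.2 hxa).ne' (Real.sqrt_pos.2 hba).ne', Real.log_sqrt hxa.le,
    Real.log_sqrt hba.le]
  ring

lemma auxG_b (a b x : ℝ) (ha : 0 < a) (hab : a < b) (hx : x ∈ Set.Ioo a b) :
    auxG a b x b = π / 2 - √(a * b) / x * (π / 2) + √(x - a) * √(b - x) / x * log (b - a) := by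
  unfold auxG
  have hb : 0 < b := ha.trans hab
  have hba : 0 < b - a := by linarith
  have hxb : 0 < b - x := by linarith [hx.2]
  have e1 : (2 * b - a - b) / (b - a) = 1 := by field_simp; ring
  have e2 : (2 * (a * b / b) - a - b) / (b - a) = -1 := by field_simp; ring
  have e3 : log (x - b) = log (b - x) := by rw [← Real.log_neg_eq_log, neg_sub]
  rw [e1, e2, arcsin_neg_one, arcsin_one, sub_self, Real.sqrt_zero, mul_zero, add_zero,
    Real.log_mul (Real.sqrt_pos.2 hba).ne' (Real.sqrt_pos.2 hxb).ne', Real.log_sqrt hxb.le,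
    Real.log_sqrt hba.le, e3]
  ring

lemma aux_inner (a b t x : ℝ) (ha : 0 < a) (hab : a < b) (hx : x ∈ Set.Ioo a b) :
    Filter.Tendsto
        (fun ε : ℝ =>
          (∫ y in a..(x - ε), t / y * Real.sqrt ((b - y) * (y - a)) / (x - y))
            + ∫ y in (x + ε)..b, t / y * Real.sqrt ((b - y) * (y - a)) / (x - y))
        (nhdsWithin 0 (Set.Ioi 0)) (nhds (t * π * (1 - √(a * b) / x))) := by
  have hx0 : 0 < x := ha.trans hx.1
  set K : ℝ → ℝ := fun y => auxG a b x y + √(x - a) * √(b - x) / x * log (x - y) with hK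
  have hKc : ContinuousAt K x := by
    have : K = fun y => arcsin ((2 * y - a - b) / (b - a)) +
        √(a * b) / x * arcsin ((2 * (a * b / y) - a - b) / (b - a))
        + √(x - a) * √(b - x) / x * (2 * log (√(y - a) * √(b - x) + √(x - a) * √(b - y))) := by
      funext y; simp only [hK, auxG]; ring
    rw [this]
    have c1 : ContinuousAt (fun y => arcsin ((2 * (a * b / y) - a - b) / (b - a))) x := by
      apply Real.continuous_arcsin.continuousAt.comp
      fun_prop (disch := exact hx0.ne')
    have c2 : ContinuousAt (fun y => arcsin ((2 * y - a - b) / (b - a))) x := by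
      apply Real.continuous_arcsin.continuousAt.comp
      fun_prop
    have c3 : ContinuousAt (fun y => log (√(y - a) * √(b - x) + √(x - a) * √(b - y))) x :=
      ContinuousAt.log (by fun_prop) (aux_pos a b x hx x ⟨hx.1.le, hx.2.le⟩).ne'
    fun_prop
  have hlim : Tendsto (fun ε : ℝ => t * π * (1 - √(a * b) / x) + t * (K (x - ε) - K (x + ε)))
      (nhds 0) (nhds (t * π * (1 - √(a * b) / x))) := by
    have m : Tendsto (fun ε : ℝ => x - ε) (nhds 0) (nhds x) := by
      have : ContinuousAt (fun ε : ℝ => x - ε) 0 := by fun_prop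
      simpa [ContinuousAt] using this
    have p : Tendsto (fun ε : ℝ => x + ε) (nhds 0) (nhds x) := by
      have : ContinuousAt (fun ε : ℝ => x + ε) 0 := by fun_prop
      simpa [ContinuousAt] using this
    have := (((hKc.tendsto.comp m).sub (hKc.tendsto.comp p)).const_mul t).const_add
      (t * π * (1 - √(a * b) / x))
    simpa using this
  refine Tendsto.congr' ?_ (hlim.mono_left nhdsWithin_le_nhds)
  have hmin : 0 < min (x - a) (b - x) := lt_min (by linarith [hx.1]) (by linarith [hx.2])
  filter_upwards [Ioo_mem_nhdsGT hmin] with ε hε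
  have h1 : ε < x - a := hε.2.trans_le (min_le_left _ _)
  have h2 : ε < b - x := hε.2.trans_le (min_le_right _ _)
  have h0 : 0 < ε := hε.1
  rw [aux_ftc a b t x ha hab hx a (x - ε) le_rfl (by linarith) (by linarith [hx.2])
      (fun y hy h => by linarith [hy.2]),
    aux_ftc a b t x ha hab hx (x + ε) b (by linarith [hx.1]) (by linarith) le_rfl
      (fun y hy h => by linarith [hy.1]), auxG_a a b x ha hab hx, auxG_b a b x ha hab hx]
  simp only [hK]
  rw [show x - (x - ε) = ε by ring, show x - (x + ε) = -ε by ring, Real.log_neg_eq_log]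
  ring

lemma aux_cv (a b : ℝ) (hab : a < b) (f : ℝ → ℝ) :
    (MeasureTheory.IntegrableOn (fun x => f x / √((b - x) * (x - a))) (Set.Ioo a b) ↔
      MeasureTheory.IntegrableOn (fun θ => f ((a + b) / 2 - (b - a) / 2 * cos θ)) (Set.Ioo 0 π)) ∧
    ∫ x in Set.Ioo a b, f x / √((b - x) * (x - a)) =
      ∫ θ in Set.Ioo 0 π, f ((a + b) / 2 - (b - a) / 2 * cos θ) := by
  set φ : ℝ → ℝ := fun θ => (a + b) / 2 - (b - a) / 2 * cos θ with hφ
  have hba : 0 < b - a := by linarith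
  have hd : ∀ θ ∈ Set.Ioo 0 π, HasDerivWithinAt φ ((b - a) / 2 * sin θ) (Set.Ioo 0 π) θ := by
    intro θ _
    have := ((Real.hasDerivAt_cos θ).const_mul ((b - a) / 2)).const_sub ((a + b) / 2)
    exact (this.congr_deriv (by ring)).hasDerivWithinAt
  have hinj : Set.InjOn φ (Set.Ioo 0 π) := by
    intro θ h1 θ' h2 h
    apply Real.injOn_cos ⟨h1.1.le, h1.2.le⟩ ⟨h2.1.le, h2.2.le⟩
    simp only [hφ] at h
    have : (b - a) / 2 * cos θ = (b - a) / 2 * cos θ' := by linarith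
    exact mul_left_cancel₀ (by positivity) this
  have him : φ '' Set.Ioo 0 π = Set.Ioo a b := by
    ext y
    constructor
    · rintro ⟨θ, hθ, rfl⟩
      have h1 : cos θ < 1 := by
        have := Real.cos_lt_cos_of_nonneg_of_le_pi le_rfl hθ.2.le hθ.1
        rwa [cos_zero] at this
      have h2 : -1 < cos θ := by
        have := Real.cos_lt_cos_of_nonneg_of_le_pi hθ.1.le le_rfl hθ.2
        rwa [cos_pi] at this
      constructor <;> simp only [hφ] <;> nlinarith
    · rintro ⟨h1, h2⟩
      have l1 : -1 < (a + b - 2 * y) / (b - a) := by rw [lt_div_iff₀ hba]; linarith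
      have l2 : (a + b - 2 * y) / (b - a) < 1 := by rw [div_lt_iff₀ hba]; linarith
      refine ⟨arccos ((a + b - 2 * y) / (b - a)), ⟨Real.arccos_pos.2 l2, ?_⟩, ?_⟩
      · refine lt_of_le_of_ne (Real.arccos_le_pi _) fun h => ?_
        rw [Real.arccos_eq_pi] at h
        linarith
      · simp only [hφ]
        rw [Real.cos_arccos l1.le l2.le]
        field_simp
        ring
  have hR : ∀ θ ∈ Set.Ioo 0 π, |(b - a) / 2 * sin θ| • (f (φ θ) / √((b - φ θ) * (φ θ - a)))
      = f (φ θ) := by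
    intro θ hθ
    have hs : 0 < sin θ := Real.sin_pos_of_mem_Ioo hθ
    have : (b - φ θ) * (φ θ - a) = ((b - a) / 2 * sin θ) ^ 2 := by
      simp only [hφ]
      linear_combination ((b - a) / 2) ^ 2 * (- Real.sin_sq_add_cos_sq θ)
    rw [this, Real.sqrt_sq (by positivity), abs_of_pos (by positivity), smul_eq_mul]
    field_simp
  constructor
  · rw [← him, MeasureTheory.integrableOn_image_iff_integrableOn_abs_deriv_smul measurableSet_Ioo hd hinj]
    exact MeasureTheory.integrableOn_congr_fun hR measurableSet_Ioo
  · rw [← him, MeasureTheory.integral_image_eq_integral_abs_deriv_smul measurableSet_Ioo hd hinj]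
    exact MeasureTheory.setIntegral_congr_fun measurableSet_Ioo hR

lemma aux_flip (a b : ℝ) (ha : 0 < a) (hab : a < b) :
    ∫ x in Set.Ioo a b, log x * (√(a * b) / x) / √((b - x) * (x - a)) =
      ∫ x in Set.Ioo a b, (log (a * b) - log x) / √((b - x) * (x - a)) := by
  have hb : 0 < b := ha.trans hab
  have hd : ∀ x ∈ Set.Ioo a b, HasDerivWithinAt (fun x => a * b / x) (-(a * b) / x ^ 2) (Set.Ioo a b) x := by
    intro y hy
    have hy0 : 0 < y := ha.trans hy.1
    have := (hasDerivAt_const y (a * b)).div (hasDerivAt_id y) hy0.ne'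
    refine (HasDerivAt.congr_deriv this ?_).hasDerivWithinAt
    simp
  have hinv : ∀ x ∈ Set.Ioo a b, a * b / (a * b / x) = x := by
    intro x hx
    have : 0 < x := ha.trans hx.1
    field_simp
  have hinj : Set.InjOn (fun x => a * b / x) (Set.Ioo a b) := by
    intro x hx y hy h
    simp only at h
    rw [← hinv x hx, h, hinv y hy]
  have him : (fun x => a * b / x) '' Set.Ioo a b = Set.Ioo a b := by
    ext y
    constructor
    · rintro ⟨x, hx, rfl⟩
      exact aux_mem a b ha hab x hx
    · intro hy
      exact ⟨a * b / y, aux_mem a b ha hab y hy, hinv y hy⟩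
  conv_lhs => rw [← him]
  rw [MeasureTheory.integral_image_eq_integral_abs_deriv_smul measurableSet_Ioo hd hinj]
  apply MeasureTheory.setIntegral_congr_fun measurableSet_Ioo
  intro x hx
  simp only
  have hx0 : 0 < x := ha.trans hx.1
  have hR : 0 < (b - x) * (x - a) := mul_pos (by linarith [hx.2]) (by linarith [hx.1])
  have hq : 0 < √((b - x) * (x - a)) := Real.sqrt_pos.2 hR
  have hs : 0 < √(a * b) := Real.sqrt_pos.2 (by positivity)
  rw [aux_R a b ha hab x hx, neg_div, abs_neg, abs_of_pos (by positivity), smul_eq_mul,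
    Real.log_div (by positivity) (by positivity)]
  field_simp

lemma aux_outer (a b : ℝ) (ha : 0 < a) (hab : a < b) :
    ∫ x in Set.Ioo a b, log x * (1 - √(a * b) / x) / √((b - x) * (x - a)) =
      4 * π * log ((√a + √b) / 2) - π * log (a * b) := by
  have hb : 0 < b := ha.trans hab
  have hpos : ∀ θ : ℝ, (a + b) / 2 - (b - a) / 2 * cos θ ≠ 0 := by
    intro θ
    have := Real.cos_le_one θ
    nlinarith
  have hc : Continuous (fun θ : ℝ => (a + b) / 2 - (b - a) / 2 * cos θ) := by fun_prop
  have hl := hc.log hpos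
  have toInt : ∀ F : ℝ → ℝ, Continuous F → MeasureTheory.IntegrableOn F (Set.Ioo 0 π) := fun F hF =>
    (hF.integrableOn_Icc).mono_set Set.Ioo_subset_Icc_self
  have i1 := (aux_cv a b hab (fun x => log x)).1.2 (toInt _ hl)
  have i2 := (aux_cv a b hab (fun x => log x * (√(a * b) / x))).1.2
    (toInt _ (hl.mul (continuous_const.div hc hpos)))
  have i3 := (aux_cv a b hab (fun x => log (a * b))).1.2 (toInt _ continuous_const)
  have v1 : ∫ x in Set.Ioo a b, log x / √((b - x) * (x - a)) = 2 * π * log ((√a + √b) / 2) := by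
    rw [(aux_cv a b hab (fun x => log x)).2, ← aux_J1 a b ha hab,
      intervalIntegral.integral_of_le Real.pi_pos.le, MeasureTheory.integral_Ioc_eq_integral_Ioo]
  have v3 : ∫ x in Set.Ioo a b, log (a * b) / √((b - x) * (x - a)) = π * log (a * b) := by
    rw [(aux_cv a b hab (fun x => log (a * b))).2]
    simp [Real.pi_pos.le]
  have e : ∀ x, log x * (1 - √(a * b) / x) / √((b - x) * (x - a)) =
      log x / √((b - x) * (x - a)) - log x * (√(a * b) / x) / √((b - x) * (x - a)) := by
    intro x; ring
  simp_rw [e]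
  rw [MeasureTheory.integral_sub i1 i2, aux_flip a b ha hab]
  simp_rw [sub_div]
  rw [MeasureTheory.integral_sub i3 i1, v1, v3]
  ring

theorem pv_double_integral (a b t : ℝ) (ha : 0 < a) (hab : a < b)
    (g : ℝ → ℝ)
    (hg : ∀ x ∈ Set.Ioo a b,
      Filter.Tendsto
        (fun ε : ℝ =>
          (∫ y in a..(x - ε), t / y * Real.sqrt ((b - y) * (y - a)) / (x - y))
            + ∫ y in (x + ε)..b, t / y * Real.sqrt ((b - y) * (y - a)) / (x - y))
        (nhdsWithin 0 (Set.Ioi 0)) (nhds (g x))) :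
    (∫ x in a..b, t * Real.log x / Real.sqrt ((b - x) * (x - a)) * g x)
      = (2 * π * t) ^ 2 *
          Real.log ((Real.sqrt a + Real.sqrt b) / (2 * (a * b) ^ ((1 : ℝ) / 4))) := by
  have hb : 0 < b := ha.trans hab
  have hgx : ∀ x ∈ Set.Ioo a b, g x = t * π * (1 - √(a * b) / x) := fun x hx =>
    tendsto_nhds_unique (hg x hx) (aux_inner a b t x ha hab hx)
  rw [intervalIntegral.integral_of_le hab.le, MeasureTheory.integral_Ioc_eq_integral_Ioo]
  have : ∫ x in Set.Ioo a b, t * Real.log x / Real.sqrt ((b - x) * (x - a)) * g x =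
      ∫ x in Set.Ioo a b, (t ^ 2 * π) * (log x * (1 - √(a * b) / x) / √((b - x) * (x - a))) := by
    apply MeasureTheory.setIntegral_congr_fun measurableSet_Ioo
    intro x hx
    simp only [hgx x hx]
    ring
  rw [this, MeasureTheory.integral_const_mul, aux_outer a b ha hab]
  have hsa : 0 < √a := Real.sqrt_pos.2 ha
  have hsb : 0 < √b := Real.sqrt_pos.2 hb
  have hab0 : 0 < a * b := by positivity
  have hr : 0 < (a * b) ^ ((1 : ℝ) / 4) := Real.rpow_pos_of_pos hab0 _
  rw [← div_div, Real.log_div (by positivity) hr.ne', Real.log_rpow hab0]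
  ring
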